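/- arXiv:0911.0343 — 3 statements merged into one kernel-verified Lean document; each statement's English description precedes it below -/
import Mathlib

section
/- Let R be a commutative ℤ-graded ring, P a homogeneous prime ideal of R, S the set of homogeneous elements of R not in P, M a graded R-module, and E a graded injective envelope of R/P (with its quotient grading). Then the degree-zero part of the localization S^{-1}M vanishes — i.e., for every homogeneous m ∈ M and every s ∈ S with deg(s) = deg(m) there exists t ∈ S with t·m = 0 — if and only if Hom_{Gr}(M,E) = 0, i.e., every degree-0 R-linear map M → E is zero. -/
/-!
STATEMENT 2: Let `R` be a commutative ℤ-graded ring, `P` a homogeneous prime ideal,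
`S` the homogeneous elements outside `P`, `M` a graded `R`-module and `E` a graded
injective envelope of `R/P` (encoded by a degree-0 linear map `φ : R → E` with kernel `P`
whose range is a graded essential submodule of the graded-injective module `E`).
Then `(S⁻¹M)₀ = 0` (in the concrete elementwise formulation) iff `Hom_Gr(M, E) = 0`.
-/

universe u

open DirectSum

/-- Compatibility of a grading on an `R`-module with the grading of `R`. -/
def CGradedSMul {R : Type u} [CommRing R] (𝒜 : ℤ → AddSubgroup R)
    {M : Type u} [AddCommGroup M] [Module R M] (ℳ : ℤ → AddSubgroup M) : Prop :=
  ∀ ⦃i j : ℤ⦄ ⦃r : R⦄ ⦃m : M⦄, r ∈ 𝒜 i → m ∈ ℳ j → r • m ∈ ℳ (i + j)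

/-- A submodule is graded if it contains all homogeneous components of its elements. -/
def IsGradedSubmodule {R : Type u} [CommRing R]
    {M : Type u} [AddCommGroup M] [Module R M] (ℳ : ℤ → AddSubgroup M)
    [DirectSum.Decomposition ℳ] (N : Submodule R M) : Prop :=
  ∀ x ∈ N, ∀ i : ℤ, (DirectSum.decompose ℳ x i : M) ∈ N

/-- `E` is graded-injective. -/
def GradedInjective {R : Type u} [CommRing R] (𝒜 : ℤ → AddSubgroup R)
    {E : Type u} [AddCommGroup E] [Module R E] (ℰ : ℤ → AddSubgroup E) : Prop :=
  ∀ (A : Type u) [AddCommGroup A] [Module R A] (ℬ : ℤ → AddSubgroup A)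
    [DirectSum.Decomposition ℬ],
    CGradedSMul 𝒜 ℬ →
    ∀ (A' : Submodule R A), IsGradedSubmodule ℬ A' →
    ∀ f : A' →ₗ[R] E,
      (∀ (i : ℤ) (x : A'), (x : A) ∈ ℬ i → f x ∈ ℰ i) →
      ∃ g : A →ₗ[R] E, (∀ i : ℤ, ∀ a ∈ ℬ i, g a ∈ ℰ i) ∧ ∀ x : A', g x = f x

/-- A graded submodule `F ⊆ E` is graded-essential. -/
def GradedEssential {R : Type u} [CommRing R]
    {E : Type u} [AddCommGroup E] [Module R E] (ℰ : ℤ → AddSubgroup E)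
    [DirectSum.Decomposition ℰ] (F : Submodule R E) : Prop :=
  ∀ N : Submodule R E, IsGradedSubmodule ℰ N → N ≠ ⊥ → N ⊓ F ≠ ⊥

theorem dec_map {A B : Type u} [AddCommGroup A] [AddCommGroup B] (ℬ : ℤ → AddSubgroup A)
    (𝒞 : ℤ → AddSubgroup B) [DirectSum.Decomposition ℬ] [DirectSum.Decomposition 𝒞]
    (g : A →+ B) (d : ℤ) (hg : ∀ i, ∀ a ∈ ℬ i, g a ∈ 𝒞 (i + d)) (x : A) (i j : ℤ) (hj : i + d = j) :
    (DirectSum.decompose 𝒞 (g x) j : B) = g (DirectSum.decompose ℬ x i : A) := by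
  subst hj
  induction x using DirectSum.Decomposition.inductionOn ℬ with
  | zero => simp
  | @homogeneous k a =>
    by_cases h : k = i
    · subst h
      rw [DirectSum.decompose_of_mem_same 𝒞 (hg _ _ a.2), DirectSum.decompose_of_mem_same ℬ a.2]
    · rw [DirectSum.decompose_of_mem_ne 𝒞 (hg _ _ a.2) (by omega),
        DirectSum.decompose_of_mem_ne ℬ a.2 h, map_zero]
  | add a b ha hb =>
    simp only [map_add, DirectSum.decompose_add, DirectSum.add_apply, AddSubgroup.coe_add, ha, hb]

theorem dec_eq_zero {B : Type u} [AddCommGroup B] (𝒞 : ℤ → AddSubgroup B)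
    [DirectSum.Decomposition 𝒞] (x : B) (h : ∀ i, (DirectSum.decompose 𝒞 x i : B) = 0) :
    x = 0 := by
  classical
  rw [← DirectSum.sum_support_decompose 𝒞 x]
  exact Finset.sum_eq_zero fun i _ => h i

theorem dec_smul {R : Type u} [CommRing R] (𝒜 : ℤ → AddSubgroup R) [GradedRing 𝒜]
    {M : Type u} [AddCommGroup M] [Module R M] (ℳ : ℤ → AddSubgroup M)
    [DirectSum.Decomposition ℳ] (hM : CGradedSMul 𝒜 ℳ) {i : ℤ} {m : M} (hm : m ∈ ℳ i)
    (r : R) (j : ℤ) :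
    (DirectSum.decompose ℳ (r • m) j : M) = (DirectSum.decompose 𝒜 r (j - i) : R) • m := by
  have h := dec_map 𝒜 ℳ (LinearMap.toSpanSingleton R M m).toAddMonoidHom i
    (fun k a ha => by simpa using hM ha hm) r (j - i) j (by omega)
  simpa using h

theorem span_graded {R : Type u} [CommRing R] (𝒜 : ℤ → AddSubgroup R) [GradedRing 𝒜]
    {M : Type u} [AddCommGroup M] [Module R M] (ℳ : ℤ → AddSubgroup M)
    [DirectSum.Decomposition ℳ] (hM : CGradedSMul 𝒜 ℳ) {i : ℤ} {m : M} (hm : m ∈ ℳ i) :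
    IsGradedSubmodule ℳ (LinearMap.range (LinearMap.toSpanSingleton R M m)) := by
  rintro _ ⟨r, rfl⟩ j
  refine ⟨(DirectSum.decompose 𝒜 r (j - i) : R), ?_⟩
  simp [dec_smul 𝒜 ℳ hM hm]

theorem stmt2 {R : Type u} [CommRing R] (𝒜 : ℤ → AddSubgroup R) [GradedRing 𝒜]
    (P : Ideal R) (hPprime : P.IsPrime)
    (hPhom : ∀ (i : ℤ) ⦃x : R⦄, x ∈ P → (DirectSum.decompose 𝒜 x i : R) ∈ P)
    {M : Type u} [AddCommGroup M] [Module R M] (ℳ : ℤ → AddSubgroup M)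
    [DirectSum.Decomposition ℳ] (hM : CGradedSMul 𝒜 ℳ)
    {E : Type u} [AddCommGroup E] [Module R E] (ℰ : ℤ → AddSubgroup E)
    [DirectSum.Decomposition ℰ] (hE : CGradedSMul 𝒜 ℰ)
    (hEinj : GradedInjective 𝒜 ℰ)
    -- `E` is an injective envelope of `R/P`: a degree-0 map `φ : R → E` with kernel `P`
    -- and graded essential image
    (φ : R →ₗ[R] E) (hφdeg : ∀ i : ℤ, ∀ r ∈ 𝒜 i, φ r ∈ ℰ i)
    (hφker : LinearMap.ker φ = P)
    (hφess : GradedEssential ℰ (LinearMap.range φ)) :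
    (∀ (i : ℤ) (m : M), m ∈ ℳ i → ∀ s : R, s ∈ 𝒜 i → s ∉ P →
        ∃ t : R, (∃ j : ℤ, t ∈ 𝒜 j) ∧ t ∉ P ∧ t • m = 0) ↔
    (∀ f : M →ₗ[R] E, (∀ i : ℤ, ∀ m ∈ ℳ i, f m ∈ ℰ i) → f = 0) := by
  constructor
  · intro H f hf
    by_contra hne
    obtain ⟨i, m, hm, hfm⟩ : ∃ i, ∃ m ∈ ℳ i, f m ≠ 0 := by
      by_contra! hc
      apply hne
      ext x
      induction x using DirectSum.Decomposition.inductionOn ℳ with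
      | zero => simp
      | @homogeneous k a => simpa using hc k a a.2
      | add a b ha hb => simpa using by rw [ha, hb]; simp
    have hem := hf i m hm
    have hN := hφess _ (span_graded 𝒜 ℰ hE hem) (by
      intro h
      apply hfm
      have : f m ∈ LinearMap.range (LinearMap.toSpanSingleton R E (f m)) := ⟨1, by simp⟩
      rw [h] at this
      simpa using this)
    obtain ⟨y, ⟨⟨r, hr⟩, ⟨a, ha⟩⟩, hy0⟩ := (Submodule.ne_bot_iff _).1 hN
    obtain ⟨j, hj⟩ : ∃ j, (DirectSum.decompose ℰ y j : E) ≠ 0 := by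
      by_contra! hc
      exact hy0 (dec_eq_zero ℰ y hc)
    have h1 : (DirectSum.decompose ℰ y j : E) = (DirectSum.decompose 𝒜 r (j - i) : R) • f m := by
      rw [← hr]
      simpa using dec_smul 𝒜 ℰ hE hem r j
    have h2 : (DirectSum.decompose ℰ y j : E) = φ (DirectSum.decompose 𝒜 a j : R) := by
      rw [← ha]
      simpa using dec_map 𝒜 ℰ φ.toAddMonoidHom 0 (fun k x hx => by simpa using hφdeg k x hx) a j j (by omega)
    have hs : (DirectSum.decompose 𝒜 a j : R) ∉ P := by
      intro h
      rw [← hφker, LinearMap.mem_ker] at h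
      exact hj (h2.trans h)
    have hmm := hM (DirectSum.decompose 𝒜 r (j - i)).2 hm
    rw [sub_add_cancel] at hmm
    obtain ⟨t, -, htP, ht⟩ := H j _ hmm _ (DirectSum.decompose 𝒜 a j).2 hs
    have h3 : φ (t * (DirectSum.decompose 𝒜 a j : R)) = 0 := by
      rw [← smul_eq_mul, map_smul, ← h2, h1, ← map_smul, ← map_smul, ht, map_zero]
    rw [← LinearMap.mem_ker, hφker] at h3
    exact (hPprime.mem_or_mem h3).elim htP hs
  · intro H i m hm s hs hsP
    by_contra! hc
    have hann : ∀ r : R, r • m = 0 → r ∈ P := by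
      intro r hr
      classical
      rw [← DirectSum.sum_support_decompose 𝒜 r]
      refine Ideal.sum_mem _ fun k _ => ?_
      by_contra hk
      refine hc _ ⟨k, (DirectSum.decompose 𝒜 r k).2⟩ hk ?_
      have := dec_smul 𝒜 ℳ hM hm r (k + i)
      rw [hr, add_sub_cancel_right] at this
      simpa using this.symm
    have hann2 : ∀ r : R, r • m = 0 → r • φ s = 0 := by
      intro r hr
      rw [← map_smul, ← LinearMap.mem_ker, hφker]
      exact P.mul_mem_right _ (hann r hr)
    let T := LinearMap.toSpanSingleton R M m
    let F : LinearMap.range T →ₗ[R] E :=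
      ((LinearMap.ker T).liftQ (LinearMap.toSpanSingleton R E (φ s)) (by
        intro r hr
        simpa using hann2 r (by simpa [T] using hr))) ∘ₗ T.quotKerEquivRange.symm.toLinearMap
    have hF : ∀ r (h : T r ∈ LinearMap.range T), F ⟨T r, h⟩ = r • φ s := by
      intro r h
      simp only [F, LinearMap.comp_apply, LinearEquiv.coe_coe]
      rw [LinearMap.quotKerEquivRange_symm_apply_image]
      exact Submodule.liftQ_apply _ _ _
    obtain ⟨g, hg, hgF⟩ := hEinj M ℳ hM (LinearMap.range T) (span_graded 𝒜 ℳ hM hm) F (by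
      rintro j ⟨_, r, rfl⟩ hx
      have h0 := hF r ⟨r, rfl⟩
      refine (congrArg (fun z => z ∈ ℰ j) h0).mpr ?_
      have hx' : r • m ∈ ℳ j := by simpa [T] using hx
      have h1 := dec_smul 𝒜 ℳ hM hm r j
      rw [DirectSum.decompose_of_mem_same ℳ hx', ← sub_eq_zero, ← sub_smul] at h1
      have h2 := hann2 _ h1
      rw [sub_smul, sub_eq_zero] at h2
      rw [h2]
      have := hE (DirectSum.decompose 𝒜 r (j - i)).2 (hφdeg i s hs)
      rwa [sub_add_cancel] at this)
    have hg0 := H g hg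
    have h4 := (hgF ⟨T 1, 1, rfl⟩).trans (hF 1 ⟨1, rfl⟩)
    rw [hg0] at h4
    apply hsP
    rw [← hφker, LinearMap.mem_ker]
    simpa using h4.symm
end

section
/- Let R be a commutative ℤ-graded ring, P a homogeneous prime ideal of R, M a graded R-module, and E a graded injective envelope of R/P (with its quotient grading). Then the localization of M at the complement of P vanishes — i.e., every element of M is annihilated by some element of R not in P — if and only if Hombar(M,E) = 0, i.e., for every d ∈ ℤ every degree-d R-linear map M → E is zero. -/
/-!
STATEMENT 4: Let `R` be a commutative ℤ-graded ring, `P` a homogeneous prime ideal,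
`M` a graded `R`-module and `E` a graded
injective envelope of `R/P` (encoded by a degree-0 linear map `φ : R → E` with kernel `P`
whose range is a graded essential submodule of the graded-injective module `E`).
Then `S⁻¹M = 0` (every element of `M` is annihilated by some element of `R` outside `P`)
iff `Hombar(M, E) = 0` (every `R`-linear map `M → E` of any degree vanishes).
-/

universe u

open DirectSum

theorem aux_decomp {A B : Type*} [AddCommGroup A] [AddCommGroup B]
    (𝒜 : ℤ → AddSubgroup A) [DirectSum.Decomposition 𝒜]
    (ℬ : ℤ → AddSubgroup B) [DirectSum.Decomposition ℬ]
    (f : A →+ B) (d : ℤ) (hf : ∀ i, ∀ a ∈ 𝒜 i, f a ∈ ℬ (i + d)) (x : A) (i : ℤ) :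
    (DirectSum.decompose ℬ (f x) (i + d) : B) = f (DirectSum.decompose 𝒜 x i : A) := by
  induction x using DirectSum.Decomposition.inductionOn 𝒜 with
  | zero => simp
  | @homogeneous j m =>
    by_cases h : j = i
    · subst h
      rw [DirectSum.decompose_of_mem_same _ (hf _ _ m.2), DirectSum.decompose_of_mem_same _ m.2]
    · rw [DirectSum.decompose_of_mem_ne _ (hf _ _ m.2) (by omega),
        DirectSum.decompose_of_mem_ne _ m.2 h, map_zero]
  | add a b ha hb => simp [ha, hb]

theorem shift_isInternal {A : Type*} [AddCommGroup A]
    (𝒜 : ℤ → AddSubgroup A) [DirectSum.Decomposition 𝒜] (k : ℤ) :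
    DirectSum.IsInternal (fun i => 𝒜 (i + k)) := by
  constructor
  · rw [injective_iff_map_eq_zero]
    intro y hy
    have key : ∀ (y : DirectSum ℤ (fun i => 𝒜 (i + k))) (i : ℤ), DirectSum.decompose 𝒜
        (DirectSum.coeAddMonoidHom (fun i => 𝒜 (i + k)) y) (i + k) = y i := by
      intro y i
      induction y using DirectSum.induction_on with
      | zero => simp
      | of j m =>
        rw [DirectSum.coeAddMonoidHom_of, DirectSum.decompose_coe]
        by_cases h : j = i
        · subst h
          rw [DirectSum.of_eq_same, DirectSum.of_eq_same]
        · rw [DirectSum.of_eq_of_ne _ _ _ (by omega), DirectSum.of_eq_of_ne _ _ _ (by omega)]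
      | add a b ha hb =>
        rw [map_add, DirectSum.decompose_add, DirectSum.add_apply, DirectSum.add_apply, ha, hb]
    ext i
    rw [← key, hy]
    simp
  · intro x
    induction x using DirectSum.Decomposition.inductionOn 𝒜 with
    | zero => exact ⟨0, map_zero _⟩
    | @homogeneous j m =>
      obtain ⟨i, rfl⟩ : ∃ i, j = i + k := ⟨j - k, by ring⟩
      exact ⟨DirectSum.of (fun i => 𝒜 (i + k)) i m,
        DirectSum.coeAddMonoidHom_of (fun i => 𝒜 (i + k)) i m⟩
    | add a b ha hb =>
      obtain ⟨a, rfl⟩ := ha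
      obtain ⟨b, rfl⟩ := hb
      exact ⟨a + b, map_add _ _ _⟩

theorem stmt4 {R : Type u} [CommRing R] (𝒜 : ℤ → AddSubgroup R) [GradedRing 𝒜]
    (P : Ideal R) (hPprime : P.IsPrime)
    (hPhom : ∀ (i : ℤ) ⦃x : R⦄, x ∈ P → (DirectSum.decompose 𝒜 x i : R) ∈ P)
    {M : Type u} [AddCommGroup M] [Module R M] (ℳ : ℤ → AddSubgroup M)
    [DirectSum.Decomposition ℳ] (hM : CGradedSMul 𝒜 ℳ)
    {E : Type u} [AddCommGroup E] [Module R E] (ℰ : ℤ → AddSubgroup E)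
    [DirectSum.Decomposition ℰ] (hE : CGradedSMul 𝒜 ℰ)
    (hEinj : GradedInjective 𝒜 ℰ)
    -- `E` is an injective envelope of `R/P`: a degree-0 map `φ : R → E` with kernel `P`
    -- and graded essential image
    (φ : R →ₗ[R] E) (hφdeg : ∀ i : ℤ, ∀ r ∈ 𝒜 i, φ r ∈ ℰ i)
    (hφker : LinearMap.ker φ = P)
    (hφess : GradedEssential ℰ (LinearMap.range φ)) :
    (∀ m : M, ∃ s : R, s ∉ P ∧ s • m = 0) ↔
    (∀ (d : ℤ) (f : M →ₗ[R] E), (∀ i : ℤ, ∀ m ∈ ℳ i, f m ∈ ℰ (i + d)) → f = 0) := by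
  constructor
  · intro h d f hf
    by_contra hne
    have key := fun x i => aux_decomp ℳ ℰ f.toAddMonoidHom d hf x i
    have hgr : IsGradedSubmodule ℰ (LinearMap.range f) := by
      rintro _ ⟨x, rfl⟩ i
      refine ⟨(DirectSum.decompose ℳ x (i - d) : M), ?_⟩
      have := key x (i - d)
      rw [sub_add_cancel] at this
      exact this.symm
    have h1 := hφess _ hgr (by rwa [Ne, LinearMap.range_eq_bot])
    obtain ⟨y, ⟨⟨x, rfl⟩, ⟨t, ht⟩⟩, hy⟩ := (Submodule.ne_bot_iff _).1 h1
    obtain ⟨s, hs, hsx⟩ := h x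
    have h2 : s * t ∈ P := by
      rw [← hφker, LinearMap.mem_ker, ← smul_eq_mul, map_smul, ht, ← map_smul, hsx, map_zero]
    rcases hPprime.mem_or_mem h2 with h3 | h3
    · exact hs h3
    · rw [← hφker, LinearMap.mem_ker, ht] at h3
      exact hy h3
  · intro h
    have hom : ∀ k, ∀ m ∈ ℳ k, ∃ s : R, s ∉ P ∧ s • m = 0 := by
      intro k m hm
      by_contra! hcon
      let g : R →ₗ[R] M := LinearMap.toSpanSingleton R M m
      have hg : ∀ r, g r = r • m := fun r => rfl
      have key := fun x i => aux_decomp 𝒜 ℳ g.toAddMonoidHom k (fun i a ha => hM ha hm) x i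
      have hker : LinearMap.ker g ≤ LinearMap.ker φ := by
        intro r hr
        rw [hφker]
        by_contra hrP
        exact hcon r hrP hr
      let f : LinearMap.range g →ₗ[R] E :=
        ((LinearMap.ker g).liftQ φ hker).comp g.quotKerEquivRange.symm.toLinearMap
      have hf : ∀ r (hr : g r ∈ LinearMap.range g), f ⟨g r, hr⟩ = φ r := by
        intro r hr
        have : g.quotKerEquivRange.symm ⟨g r, hr⟩ = (LinearMap.ker g).mkQ r :=
          g.quotKerEquivRange_symm_apply_image r hr
        simp only [f, LinearMap.comp_apply, LinearEquiv.coe_coe]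
        rw [this]
        rfl
      let _ := (shift_isInternal ℳ k).chooseDecomposition
      have hsh : ∀ x i, (DirectSum.decompose (fun i => ℳ (i + k)) x i : M)
          = DirectSum.decompose ℳ x (i + k) := by
        intro x i
        exact (aux_decomp (fun i => ℳ (i + k)) ℳ (AddMonoidHom.id M) k (fun i a ha => ha) x i).symm
      obtain ⟨F, hF, hFf⟩ := hEinj M (fun i => ℳ (i + k))
        (by
          intro i j r x hr hx
          have := hM hr hx
          rwa [← add_assoc] at this)
        (LinearMap.range g)
        (by
          rintro _ ⟨r, rfl⟩ i
          rw [hsh]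
          exact ⟨_, (key r i).symm⟩)
        f
        (by
          rintro i ⟨_, ⟨r, rfl⟩⟩ hx
          have h1 : g r = g (DirectSum.decompose 𝒜 r i : R) := by
            exact (DirectSum.decompose_of_mem_same ℳ hx).symm.trans (key r i)
          have h2 : φ r = φ (DirectSum.decompose 𝒜 r i : R) := by
            rw [← sub_eq_zero, ← map_sub]
            apply hker
            rw [LinearMap.mem_ker, map_sub, h1, sub_self]
          have h4 : f ⟨g r, ⟨r, rfl⟩⟩ = φ (DirectSum.decompose 𝒜 r i : R) := (hf r _).trans h2
          exact h4 ▸ hφdeg _ _ (DirectSum.decompose 𝒜 r i).2)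
      have hF0 := h (-k) F (by
        intro i x hx
        apply hF
        simpa using hx)
      have h3 := hFf ⟨g 1, LinearMap.mem_range_self g 1⟩
      rw [hf, hF0, LinearMap.zero_apply] at h3
      apply hPprime.one_notMem
      rw [← hφker, LinearMap.mem_ker, ← h3]
    intro m
    induction m using DirectSum.Decomposition.inductionOn ℳ with
    | zero => exact ⟨1, hPprime.one_notMem, by simp⟩
    | homogeneous m => exact hom _ _ m.2
    | add a b ha hb =>
      obtain ⟨s, hs, hsa⟩ := ha
      obtain ⟨t, ht, htb⟩ := hb
      refine ⟨s * t, fun hst => (hPprime.mem_or_mem hst).elim hs ht, ?_⟩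
      rw [smul_add, mul_smul s t b, htb, mul_comm, mul_smul, hsa, smul_zero, smul_zero, add_zero]
end

section
/- Let K be a field, R a commutative Noetherian positively graded connected K-algebra generated in degree one, and M a graded R-module which is not torsion (there exists m ∈ M such that for every n, Ann(m) does not contain R_{≥n}). Then there exists a homogeneous prime ideal P of R with P ≠ R_+ such that for every graded injective envelope E of R/P there is a nonzero degree-0 R-linear map M → E. (Hence the projections of the modules E^g(R/P), P a homogeneous prime different from the irrelevant ideal, cogenerate the quotient category Tails(R).) -/
/-!
STATEMENT 14: Let `K` be a field, `R` a commutative Noetherian positively graded connected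
`K`-algebra generated in degree one and `M` a graded `R`-module which is not torsion.
Then there is a homogeneous prime ideal `P ≠ R₊` such that for every graded injective
envelope `E` of `R/P` (encoded by a degree-0 map `φ : R → E` with kernel `P` and graded
essential range, `E` graded-injective) there is a nonzero degree-0 map `M → E`.
-/

universe u

open DirectSum

theorem comp_smul {R : Type u} [CommRing R] (𝒜 : ℤ → AddSubgroup R) [GradedRing 𝒜]
    {M : Type u} [AddCommGroup M] [Module R M] (ℳ : ℤ → AddSubgroup M)
    [DirectSum.Decomposition ℳ] (hM : CGradedSMul 𝒜 ℳ) {e : ℤ} {z : M} (hz : z ∈ ℳ e)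
    (r : R) (i : ℤ) :
    (DirectSum.decompose ℳ (r • z) i : M) = (DirectSum.decompose 𝒜 r (i - e) : R) • z := by
  induction r using DirectSum.Decomposition.inductionOn 𝒜 with
  | zero => simp
  | @homogeneous j a =>
    have h := hM a.2 hz
    by_cases hij : j + e = i
    · subst hij
      rw [DirectSum.decompose_of_mem_same ℳ h, show j + e - e = j by ring,
        DirectSum.decompose_of_mem_same 𝒜 a.2]
    · rw [DirectSum.decompose_of_mem_ne ℳ h hij,
        DirectSum.decompose_of_mem_ne 𝒜 a.2 (by omega), zero_smul]
  | add a b ha hb =>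
    rw [add_smul, DirectSum.decompose_add, DirectSum.decompose_add, DirectSum.add_apply,
      DirectSum.add_apply, AddSubgroup.coe_add, AddSubgroup.coe_add, ha, hb, add_smul]

theorem comp_mem_pow {K : Type u} {R : Type u} [Field K] [CommRing R] [Algebra K R]
    (𝒜 : ℤ → AddSubgroup R) [GradedRing 𝒜]
    (hconn : 𝒜 0 = ((algebraMap K R).range).toAddSubgroup)
    (hgen : Algebra.adjoin K ((𝒜 1 : AddSubgroup R) : Set R) = ⊤) (r : R) :
    ∀ j : ℤ, (DirectSum.decompose 𝒜 r j : R) ∈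
      (Ideal.span ((𝒜 1 : AddSubgroup R) : Set R)) ^ j.toNat := by
  have hr : r ∈ Algebra.adjoin K ((𝒜 1 : AddSubgroup R) : Set R) := by rw [hgen]; trivial
  induction hr using Algebra.adjoin_induction with
  | mem x hx =>
    intro j
    by_cases hj : 1 = j
    · subst hj
      rw [DirectSum.decompose_of_mem_same 𝒜 hx]
      simpa using Ideal.subset_span hx
    · rw [DirectSum.decompose_of_mem_ne 𝒜 hx hj]; exact zero_mem _
  | algebraMap c =>
    intro j
    have hc : algebraMap K R c ∈ 𝒜 0 := by rw [hconn]; exact ⟨c, rfl⟩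
    by_cases hj : 0 = j
    · subst hj; simp
    · rw [DirectSum.decompose_of_mem_ne 𝒜 hc hj]; exact zero_mem _
  | add x y _ _ hx hy =>
    intro j
    rw [DirectSum.decompose_add, DirectSum.add_apply, AddSubgroup.coe_add]
    exact add_mem (hx j) (hy j)
  | mul x y _ _ hx hy =>
    intro j
    classical
    rw [DirectSum.decompose_mul, DirectSum.coe_mul_apply]
    refine sum_mem fun p hp => ?_
    have hpj : p.1 + p.2 = j := (Finset.mem_filter.1 hp).2
    have h := Ideal.mul_mem_mul (hx p.1) (hy p.2)
    rw [← pow_add] at h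
    exact Ideal.pow_le_pow_right (by omega) h

theorem exists_x {K : Type u} {R : Type u} [Field K] [CommRing R] [Algebra K R]
    [IsNoetherianRing R] (𝒜 : ℤ → AddSubgroup R) [GradedRing 𝒜]
    (hconn : 𝒜 0 = ((algebraMap K R).range).toAddSubgroup)
    (hgen : Algebra.adjoin K ((𝒜 1 : AddSubgroup R) : Set R) = ⊤)
    {M : Type u} [AddCommGroup M] [Module R M]
    (m : M) (hm : ∀ n : ℤ, ¬ ∀ r ∈ ⨆ j : ℤ, ⨆ _ : n ≤ j, 𝒜 j, r • m = 0) :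
    ∃ x ∈ 𝒜 1, ∀ k : ℕ, x ^ k • m ≠ 0 := by
  by_contra! hcon
  set I : Ideal R := LinearMap.ker (LinearMap.toSpanSingleton R M m) with hI
  have hle : Ideal.span ((𝒜 1 : AddSubgroup R) : Set R) ≤ I.radical := by
    rw [Ideal.span_le]
    intro x hx
    obtain ⟨k, hk⟩ := hcon x hx
    exact ⟨k, by simpa [hI] using hk⟩
  obtain ⟨n, hn⟩ := Ideal.exists_pow_le_of_le_radical_of_fg hle (IsNoetherian.noetherian _)
  apply hm n
  have hsup : (⨆ j : ℤ, ⨆ _ : (n : ℤ) ≤ j, 𝒜 j) ≤ I.toAddSubgroup := by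
    refine iSup_le fun j => iSup_le fun hj => fun r hr => ?_
    have h := comp_mem_pow 𝒜 hconn hgen r j
    rw [DirectSum.decompose_of_mem_same 𝒜 hr] at h
    exact hn (Ideal.pow_le_pow_right (by omega) h)
  intro r hr
  have := hsup hr
  simpa [hI] using this

theorem exists_comp {R : Type u} [CommRing R]
    {M : Type u} [AddCommGroup M] [Module R M] (ℳ : ℤ → AddSubgroup M)
    [DirectSum.Decomposition ℳ] (x : R) (m : M) (hm : ∀ k : ℕ, x ^ k • m ≠ 0) :
    ∃ e : ℤ, ∃ z ∈ ℳ e, ∀ k : ℕ, x ^ k • z ≠ 0 := by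
  by_contra! hcon
  classical
  have hmem : m ∈ Submodule.torsion' R M (Submonoid.powers x) := by
    rw [← DirectSum.sum_support_decompose ℳ m]
    refine sum_mem fun i _ => ?_
    obtain ⟨k, hk⟩ := hcon i _ (DirectSum.decompose ℳ m i).2
    exact ⟨⟨x ^ k, k, rfl⟩, hk⟩
  obtain ⟨⟨_, k, rfl⟩, hk⟩ := hmem
  exact hm k hk

theorem exists_prime {R : Type u} [CommRing R]
    [IsNoetherianRing R] (𝒜 : ℤ → AddSubgroup R) [GradedRing 𝒜]
    {M : Type u} [AddCommGroup M] [Module R M] (ℳ : ℤ → AddSubgroup M)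
    [DirectSum.Decomposition ℳ] (hM : CGradedSMul 𝒜 ℳ) (x : R) (hx : x ∈ 𝒜 1)
    (h : ∃ e : ℤ, ∃ z ∈ ℳ e, ∀ k : ℕ, x ^ k • z ≠ 0) :
    ∃ (P : Ideal R) (e : ℤ) (z : M), z ∈ ℳ e ∧ (∀ r, r ∈ P ↔ r • z = 0) ∧ P.IsPrime ∧ x ∉ P := by
  let S : Set (Ideal R) := {I | ∃ e : ℤ, ∃ z ∈ ℳ e, (∀ k : ℕ, x ^ k • z ≠ 0) ∧
    I = LinearMap.ker (LinearMap.toSpanSingleton R M z)}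
  have hS : S.Nonempty := by
    obtain ⟨e, z, hz, hk⟩ := h
    exact ⟨_, e, z, hz, hk, rfl⟩
  obtain ⟨P, ⟨e, z, hz, hk, hP⟩, hmax⟩ := set_has_maximal_iff_noetherian.2 ‹_› S hS
  have hmemP : ∀ r, r ∈ P ↔ r • z = 0 := fun r => by simp [hP]
  have hxk : ∀ k : ℕ, x ^ k ∈ 𝒜 (k : ℤ) := fun k => by
    simpa using SetLike.pow_mem_graded k hx
  have key : ∀ (w : R) (d : ℤ), w ∈ 𝒜 d → (∀ k : ℕ, x ^ k • w • z ≠ 0) →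
      ∀ r, r • w • z = 0 → r ∈ P := by
    intro w d hw hkw r hr
    by_contra hrP
    refine hmax (LinearMap.ker (LinearMap.toSpanSingleton R M (w • z)))
      ⟨d + e, w • z, hM hw hz, hkw, rfl⟩ ?_
    refine lt_of_le_of_ne ?_ ?_
    · intro s hs
      have hs' := (hmemP s).1 hs
      simp only [LinearMap.mem_ker, LinearMap.toSpanSingleton_apply]
      rw [smul_comm, hs', smul_zero]
    · intro heq
      apply hrP
      rw [heq]
      simpa using hr
  refine ⟨P, e, z, hz, hmemP, ?_, fun hxP => hk 1 (by simpa using (hmemP x).1 hxP)⟩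
  have hhom : P.IsHomogeneous 𝒜 := by
    intro i r hr
    rw [hmemP] at hr ⊢
    have := comp_smul 𝒜 ℳ hM hz r (i + e)
    rw [hr, add_sub_cancel_right] at this
    simpa using this.symm
  refine Ideal.IsHomogeneous.isPrime_of_homogeneous_mem_or_mem (𝒜 := 𝒜) hhom ?_ ?_
  · intro htop
    exact hk 0 ((hmemP _).1 (htop ▸ Submodule.mem_top))
  · rintro a b ⟨i, ha⟩ ⟨j, hb⟩ hab
    by_cases hbk : ∀ k : ℕ, x ^ k • b • z ≠ 0
    · left
      refine key b j hb hbk a ?_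
      rw [← mul_smul]
      exact (hmemP _).1 hab
    · right
      push Not at hbk
      obtain ⟨k, hbk⟩ := hbk
      refine key (x ^ k) k (hxk k) (fun l => ?_) b ?_
      · rw [← mul_smul, ← pow_add]; exact hk _
      · rw [smul_comm]; exact hbk

theorem stmt14 {K : Type u} {R : Type u} [Field K] [CommRing R] [Algebra K R]
    [IsNoetherianRing R]
    (𝒜 : ℤ → AddSubgroup R) [GradedRing 𝒜]
    -- positively graded
    (hpos : ∀ i : ℤ, i < 0 → 𝒜 i = ⊥)
    -- connected: `R₀ = K`
    (hconn : 𝒜 0 = ((algebraMap K R).range).toAddSubgroup)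
    -- generated in degree one
    (hgen : Algebra.adjoin K ((𝒜 1 : AddSubgroup R) : Set R) = ⊤)
    -- `M` a graded `R`-module which is not torsion
    {M : Type u} [AddCommGroup M] [Module R M] (ℳ : ℤ → AddSubgroup M)
    [DirectSum.Decomposition ℳ] (hM : CGradedSMul 𝒜 ℳ)
    (hMnt : ∃ m : M, ∀ n : ℤ, ¬ ∀ r ∈ ⨆ j : ℤ, ⨆ _ : n ≤ j, 𝒜 j, r • m = 0) :
    ∃ P : Ideal R, P.IsPrime ∧
      (∀ (i : ℤ) ⦃x : R⦄, x ∈ P → (DirectSum.decompose 𝒜 x i : R) ∈ P) ∧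
      P.toAddSubgroup ≠ (⨆ i : ℤ, ⨆ _ : 1 ≤ i, 𝒜 i) ∧
      ∀ (E : Type u) [AddCommGroup E] [Module R E] (ℰ : ℤ → AddSubgroup E)
        [DirectSum.Decomposition ℰ],
        CGradedSMul 𝒜 ℰ → GradedInjective 𝒜 ℰ →
        ∀ φ : R →ₗ[R] E, (∀ i : ℤ, ∀ r ∈ 𝒜 i, φ r ∈ ℰ i) →
          LinearMap.ker φ = P → GradedEssential ℰ (LinearMap.range φ) →
          ∃ f : M →ₗ[R] E, (∀ i : ℤ, ∀ x ∈ ℳ i, f x ∈ ℰ i) ∧ f ≠ 0 := by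
  obtain ⟨m, hm⟩ := hMnt
  obtain ⟨x, hx, hxm⟩ := exists_x 𝒜 hconn hgen m hm
  obtain ⟨P, e, z, hz, hPz, hprime, hxP⟩ :=
    exists_prime 𝒜 ℳ hM x hx (exists_comp ℳ x m hxm)
  have hxk : ∀ k : ℕ, x ^ k ∈ 𝒜 (k : ℤ) := fun k => by
    simpa using SetLike.pow_mem_graded k hx
  have hxkP : ∀ k : ℕ, x ^ k ∉ P := fun k hk => hxP (hprime.mem_of_pow_mem k hk)
  refine ⟨P, hprime, ?_, ?_, ?_⟩
  · intro i r hr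
    rw [hPz] at hr ⊢
    have := comp_smul 𝒜 ℳ hM hz r (i + e)
    rw [hr, add_sub_cancel_right] at this
    simpa using this.symm
  · intro heq
    apply hxP
    have h1 : x ∈ (⨆ i : ℤ, ⨆ _ : 1 ≤ i, 𝒜 i) :=
      (le_iSup₂_of_le (f := fun (i : ℤ) (_ : 1 ≤ i) => 𝒜 i) 1 le_rfl le_rfl) hx
    rw [← heq] at h1
    exact h1
  · intro E _ _ ℰ _ hE hinj φ hφ hker _
    obtain ⟨c, w, hw, hPw⟩ : ∃ (c : ℕ) (w : M), w ∈ ℳ (c : ℤ) ∧ ∀ r, r ∈ P ↔ r • w = 0 := by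
      refine ⟨e.toNat, x ^ (-e).toNat • z, ?_, fun r => ?_⟩
      · have := hM (hxk (-e).toNat) hz
        rwa [show (((-e).toNat : ℕ) : ℤ) + e = (e.toNat : ℤ) by omega] at this
      · rw [← mul_smul, ← hPz]
        exact ⟨fun h => Ideal.mul_mem_right _ _ h,
          fun h => (hprime.mem_or_mem h).resolve_right (hxkP _)⟩
    let T : R →ₗ[R] M := LinearMap.toSpanSingleton R M w
    let ψ : R →ₗ[R] E := φ ∘ₗ LinearMap.mulRight R (x ^ c)
    have hT : ∀ r, T r = r • w := fun r => rfl
    have hψ : ∀ r, ψ r = φ (r * x ^ c) := fun r => rfl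
    have hle : LinearMap.ker T ≤ LinearMap.ker ψ := by
      intro r hr
      rw [LinearMap.mem_ker, hT, ← hPw] at hr
      rw [LinearMap.mem_ker, hψ, ← LinearMap.mem_ker, hker]
      exact Ideal.mul_mem_right _ _ hr
    let f : LinearMap.range T →ₗ[R] E :=
      ((LinearMap.ker T).liftQ ψ hle) ∘ₗ (T.quotKerEquivRange.symm : _ →ₗ[R] _)
    have hf : ∀ (r : R) (h : T r ∈ LinearMap.range T), f ⟨T r, h⟩ = ψ r := by
      intro r h
      have : T.quotKerEquivRange.symm ⟨T r, h⟩ = (LinearMap.ker T).mkQ r :=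
        T.quotKerEquivRange_symm_apply_image r h
      simp only [f, LinearMap.comp_apply, LinearEquiv.coe_coe, this]
      rfl
    obtain ⟨g, hg, hgf⟩ := hinj M ℳ hM (LinearMap.range T) (by
      rintro _ ⟨r, rfl⟩ i
      rw [hT, comp_smul 𝒜 ℳ hM hw]
      exact ⟨_, rfl⟩) f (by
      rintro i ⟨_, r, rfl⟩ hi
      have h2 := comp_smul 𝒜 ℳ hM hw r i
      change T r ∈ ℳ i at hi
      rw [← hT, DirectSum.decompose_of_mem_same ℳ hi, ← hT] at h2
      have h3 : f ⟨T r, ⟨r, rfl⟩⟩ = ψ (DirectSum.decompose 𝒜 r (i - c) : R) := by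
        rw [← hf _ ⟨_, rfl⟩]
        congr 2
      rw [h3, hψ]
      apply hφ
      have h4 := SetLike.mul_mem_graded (DirectSum.decompose 𝒜 r (i - c)).2 (hxk c)
      rwa [sub_add_cancel] at h4)
    refine ⟨g, hg, fun h0 => hxkP c ?_⟩
    have h5 := hgf ⟨T 1, ⟨1, rfl⟩⟩
    have h6 := h5.trans (hf 1 _)
    rw [hψ, h0, one_mul, LinearMap.zero_apply] at h6
    rw [← hker]
    exact h6.symm
end
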